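/- arXiv:2112.15205 — 2 statements merged into one kernel-verified Lean document; each statement's English description precedes it below -/
import Mathlib

section
/- Let S be a finite nonempty set of marked compositions all of whose norms have the same parity, let n := max_{x∈S} |x|, and let Θ := {y : y ⪯ x for some x ∈ S} be the closed poset generated by S. Then for every natural number q, every y ∈ Θ with |y|' ≤ q satisfies |y| ≤ n + 2q. In particular, for every q the set {y ∈ Θ : |y|' ≤ q} is finite, i.e. Θ is profinite. -/
/-- A composition: a (possibly empty) list of positive integers. -/
abbrev Comp : Type := List PNat

/-- A marked composition: a composition together with a mark `κ : ℕ`. -/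
abbrev MComp : Type := List PNat × ℕ

/-- The norm `|ω|` of a composition. -/
def normC (ω : Comp) : ℕ := (ω.map fun a => (a : ℕ)).sum

/-- The reduced norm `|ω|' = |ω| - ℓ` of a composition. -/
def rnormC (ω : Comp) : ℕ := normC ω - ω.length

/-- The norm of a marked composition. -/
def normM (x : MComp) : ℕ := normC x.1 + x.2

/-- The reduced norm of a marked composition. -/
def rnormM (x : MComp) : ℕ := rnormC x.1 + x.2

/-- Merge the parts at (0-indexed) positions `k` and `k+1` of a composition. -/
def mergeAux : Comp → ℕ → Comp
  | a :: b :: t, 0 => (a + b) :: t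
  | a :: t, n + 1 => a :: mergeAux t n
  | l, _ => l

/-- The merge operation `M_k^∞` (`0 ≤ k ≤ ℓ`) on marked compositions:
`M_0^∞` moves the first part to the mark, `M_ℓ^∞` moves the last part to the mark, and
for `1 ≤ k ≤ ℓ-1`, `M_k^∞` merges the `k`-th and `(k+1)`-st parts (1-indexed). -/
def mergeM (x : MComp) (k : ℕ) : MComp :=
  if k = 0 then
    match x.1 with
    | [] => x
    | a :: t => (t, x.2 + (a : ℕ))
  else if k = x.1.length then
    match x.1.getLast? with
    | none => x
    | some a => (x.1.dropLast, x.2 + (a : ℕ))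
  else (mergeAux x.1 (k - 1), x.2)

/-- The insert operation `I_k` (`0 ≤ k ≤ ℓ`): insert a part `2` after the first `k` parts. -/
def insertC (ω : Comp) (k : ℕ) : Comp := ω.take k ++ (2 : PNat) :: ω.drop k

/-- The insert operation `I_k^∞` on marked compositions. -/
def insertM (x : MComp) (k : ℕ) : MComp := (insertC x.1 k, x.2)

/-- One merge or insert step on marked compositions: `mstep y x` means `x` is
obtained from `y` by a single operation. -/
def mstep (y x : MComp) : Prop :=
  (∃ k ≤ y.1.length, y.1 ≠ [] ∧ x = mergeM y k) ∨ ∃ k ≤ y.1.length, x = insertM y k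

/-- `mprec x y` is the relation `x ⪯ y` on marked compositions. -/
def mprec (x y : MComp) : Prop := Relation.ReflTransGen mstep y x

/-- One merge or insert step on compositions: merges `M_j`, `1 ≤ j ≤ ℓ-1`
(0-indexed: positions `k, k+1` with `k + 2 ≤ ℓ`), and all inserts. -/
def cstep (y x : Comp) : Prop :=
  (∃ k, k + 2 ≤ y.length ∧ x = mergeAux y k) ∨ ∃ k ≤ y.length, x = insertC y k

/-- `cprec x y` is the relation `x ⪯ y` on compositions. -/
def cprec (x y : Comp) : Prop := Relation.ReflTransGen cstep y x

theorem normC_nil : normC [] = 0 := rfl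

theorem normC_cons (a : PNat) (t : Comp) : normC (a :: t) = (a : ℕ) + normC t := by
  simp [normC]

theorem normC_append (s t : Comp) : normC (s ++ t) = normC s + normC t := by
  simp [normC]

theorem length_le_normC (l : Comp) : l.length ≤ normC l := by
  induction l with
  | nil => simp
  | cons a t ih =>
    have := a.pos
    rw [normC_cons, List.length_cons]
    omega

theorem mergeAux_prop (l : Comp) (k : ℕ) :
    normC (mergeAux l k) = normC l ∧ (mergeAux l k).length ≤ l.length := by
  fun_induction mergeAux l k with
  | case1 a b t => simp [normC_cons, add_assoc]
  | case2 a t n ih => simp [normC_cons, ih]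
  | case3 l k => simp

theorem mergeM_prop (x : MComp) (k : ℕ) :
    normM (mergeM x k) = normM x ∧ (mergeM x k).1.length ≤ x.1.length := by
  obtain ⟨l, c⟩ := x
  by_cases h0 : k = 0
  · cases l with
    | nil => simp [mergeM, h0]
    | cons a t =>
      simp [mergeM, h0, normM, normC_cons]
      omega
  · by_cases h1 : k = l.length
    · rcases List.eq_nil_or_concat l with h | ⟨t, a, h⟩
      · subst h
        exact absurd h1 h0
      · subst h
        simp at h1
        simp [mergeM, h1, normM, normC_append, normC_cons, normC_nil]
        omega
    · have := mergeAux_prop l (k - 1)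
      simp [mergeM, h0, h1, normM, this]

theorem insertM_prop (x : MComp) (k : ℕ) (hk : k ≤ x.1.length) :
    normM (insertM x k) = normM x + 2 ∧ (insertM x k).1.length = x.1.length + 1 := by
  obtain ⟨l, c⟩ := x
  have h := normC_append (l.take k) (l.drop k)
  rw [List.take_append_drop] at h
  simp only at hk
  have h2 : ((2 : PNat) : ℕ) = 2 := rfl
  simp only [insertM, insertC, normM, normC_append, normC_cons, List.length_append,
    List.length_cons, List.length_take, List.length_drop, h, h2]
  omega

theorem invariant_of_mprec (n : ℕ) (x y : MComp) (hx : normM x ≤ n) (h : mprec y x) :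
    2 * y.1.length ≤ n + normM y := by
  unfold mprec at h
  induction h with
  | refl =>
    have := length_le_normC x.1
    unfold normM at *
    omega
  | tail _ hs ih =>
    rcases hs with ⟨k, _, _, rfl⟩ | ⟨k, hk, rfl⟩
    · rename_i b _ _ _
      have := mergeM_prop b k
      omega
    · have := insertM_prop _ k hk
      omega

theorem part_le_normC (l : Comp) (a : PNat) (ha : a ∈ l) : (a : ℕ) ≤ normC l := by
  induction l with
  | nil => simp at ha
  | cons b t ih =>
    rw [normC_cons]
    rcases List.mem_cons.1 ha with rfl | h
    · omega
    · have := ih h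
      omega

theorem finite_normC_le (N : ℕ) : {l : Comp | normC l ≤ N}.Finite := by
  refine ((List.finite_length_le (Fin (N + 1)) N).image
    (List.map fun i : Fin (N + 1) => Nat.toPNat' (i : ℕ))).subset ?_
  intro l hl
  simp only [Set.mem_ofPred_eq] at hl
  refine ⟨l.map fun a : PNat => Fin.ofNat (N + 1) (a : ℕ), ?_, ?_⟩
  · have := length_le_normC l
    simp
    omega
  · rw [List.map_map]
    conv_rhs => rw [← List.map_id l]
    refine List.map_congr_left fun a ha => ?_
    have h := part_le_normC l a ha
    have h2 : (a : ℕ) % (N + 1) = a := Nat.mod_eq_of_lt (by omega)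
    simp [h2]

/-- Let `S` be a finite nonempty set of marked compositions of equal parity,
`n` the maximum of their norms, and `Θ = {y | y ⪯ x for some x ∈ S}` the closed poset
generated by `S`. Then every `y ∈ Θ` with `|y|' ≤ q` satisfies `|y| ≤ n + 2q`; in
particular `{y ∈ Θ | |y|' ≤ q}` is finite for every `q`, i.e. `Θ` is profinite. -/
theorem finitely_generated_is_profinite (S : Finset MComp) (hne : S.Nonempty)
    (hpar : ∀ x ∈ S, ∀ y ∈ S, normM x % 2 = normM y % 2)
    (n : ℕ) (hn : IsGreatest {m : ℕ | ∃ x ∈ S, m = normM x} n) :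
    (∀ q : ℕ, ∀ y : MComp, (∃ x ∈ S, mprec y x) → rnormM y ≤ q → normM y ≤ n + 2 * q) ∧
    ∀ q : ℕ, {y : MComp | (∃ x ∈ S, mprec y x) ∧ rnormM y ≤ q}.Finite := by
  have key : ∀ q : ℕ, ∀ y : MComp, (∃ x ∈ S, mprec y x) → rnormM y ≤ q →
      normM y ≤ n + 2 * q := by
    rintro q y ⟨x, hx, hyx⟩ hq
    have h1 := invariant_of_mprec n x y (hn.2 ⟨x, hx, rfl⟩) hyx
    have h2 := length_le_normC y.1
    unfold rnormM rnormC at hq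
    unfold normM at *
    omega
  refine ⟨key, fun q => ?_⟩
  refine ((finite_normC_le (n + 2 * q)).prod (Set.finite_Iic (n + 2 * q))).subset ?_
  rintro y ⟨hy, hq⟩
  have h := key q y hy hq
  unfold normM at h
  simp only [Set.mem_prod, Set.mem_ofPred_eq, Set.mem_Iic]
  omega
end

section
/- For all integers d ≥ 0 and 0 ≤ j ≤ d, the number of marked compositions x with |x| ≤ d, |x| ≡ d (mod 2) and |x|' = d − j equals Σ_{k=0}^{⌊j/2⌋} binom(d−2k, j−2k). (This is the closed coefficient form of the generating function identity Σ_{d≥0} G(B_d;t)x^d = 1/((1−t²x²)(1−x−tx)), where the left-hand side counts the j-dimensional cells of the cellulated real projective space B_d ≅ ℝP^d.) -/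
def consOneM (x : MComp) : MComp := ((1 : PNat) :: x.1, x.2)

def incrHeadM : MComp → MComp
  | ([], k) => ([], k + 1)
  | (a :: t, k) => ((a + 1) :: t, k)

theorem consOneM_inj : Function.Injective consOneM := by
  rintro ⟨a, b⟩ ⟨c, e⟩ h
  simpa [consOneM] using h

theorem incrHeadM_inj : Function.Injective incrHeadM := by
  rintro ⟨_ | ⟨a, t⟩, b⟩ ⟨_ | ⟨c, u⟩, e⟩ h <;> simpa [incrHeadM] using h

def cellsF : ℕ → ℕ → Finset MComp
  | n, 0 => {([], n)}
  | 0, _ + 1 => ∅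
  | n + 1, l + 1 => (cellsF n l).map ⟨consOneM, consOneM_inj⟩ ∪
      (cellsF n (l + 1)).map ⟨incrHeadM, incrHeadM_inj⟩

theorem mem_cellsF (n l : ℕ) (x : MComp) :
    x ∈ cellsF n l ↔ normM x = n ∧ x.1.length = l := by
  induction n generalizing l x with
  | zero =>
    obtain ⟨w, k⟩ := x
    cases l with
    | zero => cases w <;> simp [cellsF, normM, normC]
    | succ l =>
      cases w with
      | nil => simp [cellsF]
      | cons a t =>
        have := a.pos
        simp [cellsF, normM, normC]
  | succ n ih =>
    obtain ⟨w, k⟩ := x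
    cases l with
    | zero => cases w <;> simp [cellsF, normM, normC]
    | succ l =>
      simp only [cellsF, Finset.mem_union, Finset.mem_map, Function.Embedding.coeFn_mk, ih]
      constructor
      · rintro (⟨⟨u, m⟩, ⟨h1, h2⟩, h⟩ | ⟨⟨_ | ⟨b, u⟩, m⟩, ⟨h1, h2⟩, h⟩)
        · simp only [consOneM, Prod.mk.injEq] at h
          obtain ⟨rfl, rfl⟩ := h
          simp [normM, normC] at *
          omega
        · simp at h2
        · simp only [incrHeadM, Prod.mk.injEq] at h
          obtain ⟨rfl, rfl⟩ := h
          simp [normM, normC] at *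
          omega
      · rintro ⟨h1, h2⟩
        cases w with
        | nil => simp at h2
        | cons a t =>
          induction a using PNat.recOn with
          | one =>
            left
            refine ⟨(t, k), ?_, rfl⟩
            simp [normM, normC] at *
            omega
          | succ a _ =>
            right
            refine ⟨(a :: t, k), ?_, rfl⟩
            simp [normM, normC] at *
            omega

theorem card_cellsF (n l : ℕ) : (cellsF n l).card = n.choose l := by
  induction n generalizing l with
  | zero => cases l <;> simp [cellsF]
  | succ n ih =>
    cases l with
    | zero => simp [cellsF]
    | succ l =>
      rw [cellsF, Finset.card_union_of_disjoint, Finset.card_map, Finset.card_map, ih, ih,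
        Nat.choose_succ_succ]
      rw [Finset.disjoint_left]
      simp only [Finset.mem_map, Function.Embedding.coeFn_mk, mem_cellsF]
      rintro _ ⟨⟨u, m⟩, _, rfl⟩ ⟨⟨_ | ⟨b, v⟩, m'⟩, ⟨_, h2⟩, h⟩
      · simp at h2
      · simp only [incrHeadM, consOneM, Prod.mk.injEq, List.cons.injEq] at h
        have h3 := congrArg PNat.val h.1.1
        have := b.pos
        simp at h3

theorem length_le_normC_s19 (w : Comp) : w.length ≤ normC w := by
  induction w with
  | nil => simp
  | cons a t ih =>
    have ha : 1 ≤ (a : ℕ) := a.pos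
    have hc : normC (a :: t) = a + normC t := by simp [normC]
    rw [hc, List.length_cons]
    omega

/-- For `0 ≤ j ≤ d`, the number of marked compositions `x` with
`|x| ≤ d`, `|x| ≡ d (mod 2)` and `|x|' = d - j` equals `Σ_{k=0}^{⌊j/2⌋} C(d-2k, j-2k)`. -/
theorem count_cells_projective_case (d j : ℕ) (hj : j ≤ d) :
    {x : MComp | normM x ≤ d ∧ normM x % 2 = d % 2 ∧
        (rnormM x : ℤ) = (d : ℤ) - (j : ℤ)}.ncard =
      ∑ k ∈ Finset.range (j / 2 + 1), Nat.choose (d - 2 * k) (j - 2 * k) := by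
  have hset : {x : MComp | normM x ≤ d ∧ normM x % 2 = d % 2 ∧
        (rnormM x : ℤ) = (d : ℤ) - (j : ℤ)} =
      ((Finset.range (j / 2 + 1)).biUnion fun k => cellsF (d - 2 * k) (j - 2 * k) :
        Finset MComp) := by
    ext x
    have hl := length_le_normC_s19 x.1
    simp only [Set.mem_ofPred_eq, Finset.coe_biUnion, Set.mem_iUnion, Finset.mem_coe,
      Finset.mem_range, mem_cellsF, rnormM, rnormC, normM, exists_prop]
    constructor
    · rintro ⟨h1, h2, h3⟩
      refine ⟨(d - (normC x.1 + x.2)) / 2, ?_, ?_, ?_⟩ <;> omega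
    · rintro ⟨k, h1, h2, h3⟩
      refine ⟨?_, ?_, ?_⟩ <;> omega
  rw [hset, Set.ncard_coe_finset, Finset.card_biUnion]
  · simp only [card_cellsF]
  · intro a ha b hb hab
    rw [Function.onFun, Finset.disjoint_left]
    intro x hx hy
    simp only [Finset.coe_range, Set.mem_Iio] at ha hb
    rw [mem_cellsF] at hx hy
    omega
end
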